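/- Let k be a field of characteristic zero and V a finite-dimensional k-vector space of dimension n. Let 2 ≤ N ≤ n and let f ∈ 𝒱^N be a nonzero antisymmetric element; set R := span_k{f}. For m ≥ N let S_m := ⨆_{p+q=m−N} 𝒱^p · R · 𝒱^q, and S_m = ⊥ for m < N. Define a_m := (finrank_k 𝒱^m) − (finrank_k S_m) ∈ ℤ. Then a_m = n^m for 0 ≤ m ≤ N−1 and a_m = n·a_{m−1} − a_{m−N} for every m ≥ N. (Hilbert series H_A(t) = (1 − n t + t^N)^{-1} for the algebra defined by a single antisymmetric relation.) -/

import Mathlib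

/-- The degree-one part of the tensor algebra. -/
noncomputable def degreeOne (k : Type*) [CommSemiring k] (V : Type*) [AddCommMonoid V]
    [Module k V] : Submodule k (TensorAlgebra k V) :=
  LinearMap.range (TensorAlgebra.ι k : V →ₗ[k] TensorAlgebra k V)

/-- The antisymmetriser `Ant(v_1, …, v_r) = Σ_{σ ∈ S_r} sgn(σ) v_{σ(1)} ⋯ v_{σ(r)}`
inside the tensor algebra. -/
noncomputable def antisymmetriser (k : Type*) [CommRing k] {V : Type*} [AddCommGroup V]
    [Module k V] (r : ℕ) (v : Fin r → V) : TensorAlgebra k V :=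
  ∑ σ : Equiv.Perm (Fin r),
    (Equiv.Perm.sign σ : ℤ) • (List.ofFn fun i => TensorAlgebra.ι k (v (σ i))).prod

/-- An element of the tensor algebra is antisymmetric of degree `r` if it lies in the span
of the antisymmetrisers `Ant(v_1, …, v_r)`. -/
def IsAntisymmetric (k : Type*) [CommRing k] {V : Type*} [AddCommGroup V] [Module k V]
    (r : ℕ) (a : TensorAlgebra k V) : Prop :=
  a ∈ Submodule.span k (Set.range (antisymmetriser k r))

open Module Submodule

section Words

variable {α : Type*}

/-- The words of length `m` that do not contain `w` as a factor. -/
def wordsAvoiding (w : List α) (m : ℕ) : Set (List α) :=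
  {l | l.length = m ∧ ¬ w <:+: l}

theorem wordsAvoiding_finite [Finite α] (w : List α) (m : ℕ) : (wordsAvoiding w m).Finite :=
  (List.finite_length_eq α m).subset fun _ h => h.1

theorem ncard_setOf_length_eq [Fintype α] (m : ℕ) :
    {l : List α | l.length = m}.ncard = Fintype.card α ^ m := by
  rw [← Nat.card_coe_set_eq, ← card_vector (α := α) m, ← Nat.card_eq_fintype_card]
  rfl

/-- A word starting with a letter that does not reappear in `u` can occur in `u ++ v` only
inside `v`. -/
theorem infix_of_cons_infix_append {x : α} {t u v : List α} (hx : x ∉ u)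
    (h : x :: t <:+: u ++ v) : x :: t <:+: v := by
  induction u with
  | nil => exact h
  | cons y u ih =>
    rw [List.cons_append, List.infix_cons_iff] at h
    rw [List.mem_cons, not_or] at hx
    rcases h with h | h
    · exact absurd (List.cons_prefix_cons.mp h).1 hx.1
    · exact ih hx.2 h

/-- A word without repeated letters has no self-overlaps, which bounds the number of words
avoiding it. -/
theorem ncard_wordsAvoiding_add_le [Fintype α] {x : α} {t : List α} (hx : x ∉ t) (d : ℕ) :
    (wordsAvoiding (x :: t) (d + t.length + 1)).ncard + (wordsAvoiding (x :: t) d).ncard ≤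
      Fintype.card α * (wordsAvoiding (x :: t) (d + t.length)).ncard := by
  have hinj : Function.Injective fun u : List α => x :: t ++ u :=
    List.append_right_injective (x :: t)
  have hcons : Function.Injective fun p : α × List α => p.1 :: p.2 := by
    rintro ⟨a, l⟩ ⟨b, l'⟩ h
    simpa using h
  have hdisj : Disjoint (wordsAvoiding (x :: t) (d + t.length + 1))
      ((fun u : List α => x :: t ++ u) '' wordsAvoiding (x :: t) d) := by
    rw [Set.disjoint_left]
    rintro _ h ⟨u, -, rfl⟩
    exact h.2 List.infix_append_left
  rw [← Set.ncard_image_of_injective (wordsAvoiding (x :: t) d) hinj,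
    ← Set.ncard_union_eq hdisj (wordsAvoiding_finite _ _)
      ((wordsAvoiding_finite _ _).image _), ← Nat.card_eq_fintype_card, ← Set.ncard_univ,
    ← Set.ncard_prod, ← Set.ncard_image_of_injective _ hcons]
  refine Set.ncard_le_ncard ?_ ((Set.finite_univ.prod (wordsAvoiding_finite _ _)).image _)
  rintro l (⟨hl, hw⟩ | ⟨u, ⟨hu, hw⟩, rfl⟩)
  · cases l with
    | nil => simp at hl
    | cons y l =>
      exact ⟨(y, l), ⟨trivial, by simpa using hl,
        fun h => hw (List.infix_cons_iff.mpr (Or.inr h))⟩, rfl⟩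
  · exact ⟨(x, t ++ u), ⟨trivial, by simp [hu, add_comm],
      fun h => hw (infix_of_cons_infix_append hx h)⟩, rfl⟩

/-- The number whose base `n` expansion (least significant digit first) is the given word. -/
def wordValue {n : ℕ} (l : List (Fin n)) : ℕ :=
  Nat.ofDigits n (l.map Fin.val)

theorem eq_of_wordValue_eq {n : ℕ} (hn : 1 < n) {l l' : List (Fin n)} (hlen : l.length = l'.length)
    (h : wordValue l = wordValue l') : l = l' := by
  refine Fin.val_injective.list_map (Nat.ofDigits_inj_of_len_eq hn (by simpa using hlen) ?_ ?_ h)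
  all_goals
    intro a ha
    obtain ⟨i, -, rfl⟩ := List.mem_map.mp ha
    exact i.2

theorem wordValue_append_lt {n : ℕ} (hn : 1 < n) {l l' : List (Fin n)}
    (hlen : l.length = l'.length) (h : wordValue l < wordValue l') (p q : List (Fin n)) :
    wordValue (p ++ l ++ q) < wordValue (p ++ l' ++ q) := by
  simp only [wordValue, List.map_append, Nat.ofDigits_append, List.length_append,
    List.length_map, hlen] at h ⊢
  gcongr

end Words

section TensorWords

variable {k V α : Type*} [Field k] [AddCommGroup V] [Module k V]

/-- The product in the tensor algebra of the basis vectors labelled by a word. -/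
noncomputable def wordProduct (b : Basis α k V) (l : List α) : TensorAlgebra k V :=
  (l.map fun i => TensorAlgebra.ι k (b i)).prod

theorem wordProduct_append (b : Basis α k V) (l l' : List α) :
    wordProduct b (l ++ l') = wordProduct b l * wordProduct b l' := by
  simp [wordProduct]

theorem basis_tensorAlgebra_apply (b : Basis α k V) (l : List α) :
    b.tensorAlgebra (FreeMonoid.ofList l) = wordProduct b l := by
  simp [Basis.tensorAlgebra, FreeAlgebra.basisFreeMonoid, wordProduct,
    FreeAlgebra.equivMonoidAlgebraFreeMonoid, FreeMonoid.lift_apply, map_list_prod,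
    Function.comp_def]

theorem coe_basis_tensorAlgebra (b : Basis α k V) : ⇑b.tensorAlgebra = wordProduct b :=
  funext (basis_tensorAlgebra_apply b)

theorem degreeOne_pow_eq_span (b : Basis α k V) (m : ℕ) :
    degreeOne k V ^ m = span k (wordProduct b '' {l | l.length = m}) := by
  have hone : degreeOne k V = span k (Set.range fun i => TensorAlgebra.ι k (b i)) := by
    rw [degreeOne, ← Submodule.map_top, ← b.span_eq, Submodule.map_span, ← Set.range_comp]
    rfl
  induction m with
  | zero =>
    have : {l : List α | l.length = 0} = {[]} := by ext; simp
    rw [pow_zero, this, Set.image_singleton, Submodule.one_eq_span]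
    rfl
  | succ m ih =>
    rw [pow_succ', ih, hone, Submodule.span_mul_span]
    congr 1
    ext y
    constructor
    · rintro ⟨_, ⟨i, rfl⟩, _, ⟨l, hl, rfl⟩, rfl⟩
      exact ⟨i :: l, by simpa using hl, by simp [wordProduct]⟩
    · rintro ⟨_ | ⟨i, l⟩, hl, rfl⟩
      · simp at hl
      · exact ⟨_, ⟨i, rfl⟩, _, ⟨l, by simpa using hl, rfl⟩, by simp [wordProduct]⟩

theorem wordProduct_mem_pow (b : Basis α k V) (l : List α) :
    wordProduct b l ∈ degreeOne k V ^ l.length := by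
  rw [degreeOne_pow_eq_span b]
  exact subset_span ⟨l, rfl, rfl⟩

theorem finrank_degreeOne_pow [FiniteDimensional k V] (m : ℕ) :
    finrank k (degreeOne k V ^ m : Submodule k (TensorAlgebra k V)) = finrank k V ^ m := by
  let b := finBasis k V
  have hli : LinearIndependent k (wordProduct b) := by
    rw [← coe_basis_tensorAlgebra]
    exact b.tensorAlgebra.linearIndependent
  have := (List.finite_length_eq (Fin (finrank k V)) m).fintype
  rw [degreeOne_pow_eq_span b, Set.image_eq_range]
  refine (finrank_span_eq_card (hli.comp _ Subtype.val_injective)).trans ?_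
  rw [← Nat.card_eq_fintype_card, Nat.card_coe_set_eq, ncard_setOf_length_eq, Fintype.card_fin]

instance finiteDimensional_degreeOne_pow [FiniteDimensional k V] (m : ℕ) :
    FiniteDimensional k (degreeOne k V ^ m : Submodule k (TensorAlgebra k V)) := by
  have h : (degreeOne k V).FG := by
    rw [degreeOne, ← Submodule.map_top]
    exact Module.Finite.fg_top.map _
  exact Module.Finite.iff_fg.mpr (h.pow m)

theorem antisymmetriser_eq_alternatization (r : ℕ) (v : Fin r → V) :
    antisymmetriser k r v = MultilinearMap.alternatization (TensorAlgebra.tprod k V r) v := by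
  rw [MultilinearMap.alternatization_apply]
  rfl

/-- Antisymmetric tensors involve only words without repeated letters. -/
theorem IsAntisymmetric.mem_span_nodup [Fintype α] (b : Basis α k V) {r : ℕ}
    {f : TensorAlgebra k V} (hf : IsAntisymmetric k r f) :
    f ∈ span k (wordProduct b '' {l | l.length = r ∧ l.Nodup}) := by
  classical
  refine (span_le.mpr ?_ : span k _ ≤ _) hf
  rintro _ ⟨v, rfl⟩
  rw [antisymmetriser_eq_alternatization]
  set g := MultilinearMap.alternatization (TensorAlgebra.tprod k V r) with hg
  have hv : v = fun i => ∑ j, b.repr (v i) j • b j := by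
    funext i
    exact (b.sum_repr (v i)).symm
  rw [hv, ← AlternatingMap.coe_multilinearMap, MultilinearMap.map_sum]
  refine sum_mem fun s _ => ?_
  rw [MultilinearMap.map_smul_univ]
  refine smul_mem _ _ ?_
  rw [AlternatingMap.coe_multilinearMap]
  by_cases hs : Function.Injective s
  · rw [hg, ← antisymmetriser_eq_alternatization, antisymmetriser]
    refine sum_mem fun σ _ => zsmul_mem (subset_span ?_) _
    refine ⟨List.ofFn fun i => s (σ i), ⟨by simp, ?_⟩, ?_⟩
    · exact List.nodup_ofFn.mpr (hs.comp σ.injective)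
    · simp [wordProduct, List.map_ofFn, Function.comp_def]
  · obtain ⟨i, j, hij, hne⟩ : ∃ i j, s i = s j ∧ i ≠ j := by
      simpa [Function.Injective] using hs
    rw [g.map_eq_zero_of_eq _ (by simp [hij]) hne]
    exact zero_mem _

/-- A nonzero element supported on words of length `r` without repeated letters has a leading
word with respect to `wordValue`. -/
theorem exists_leading_word {n r : ℕ} (hn : 1 < n) (b : Basis (Fin n) k V)
    {f : TensorAlgebra k V} (hf0 : f ≠ 0)
    (hf : f ∈ span k (wordProduct b '' {l | l.length = r ∧ l.Nodup})) :
    ∃ w : List (Fin n), w.length = r ∧ w.Nodup ∧ ∃ c : k, c ≠ 0 ∧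
      f - c • wordProduct b w ∈
        span k (wordProduct b '' {l | l.length = r ∧ wordValue l < wordValue w}) := by
  classical
  rw [← coe_basis_tensorAlgebra] at hf ⊢
  set B := b.tensorAlgebra
  have hsupp : ∀ l ∈ (B.repr f).support, List.length l = r ∧ List.Nodup l :=
    fun l hl => B.mem_span_image.mp hf hl
  have hne : (B.repr f).support.Nonempty := by simpa using hf0
  obtain ⟨w, hw, hmax⟩ := (B.repr f).support.exists_max_image wordValue hne
  refine ⟨w, (hsupp w hw).1, (hsupp w hw).2, B.repr f w, Finsupp.mem_support_iff.mp hw,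
    B.mem_span_image.mpr ?_⟩
  intro l hl
  have hlw : l ≠ w := by
    rintro rfl
    simp at hl
  have hl' : l ∈ (B.repr f).support := by
    simpa [Finsupp.single_apply, hlw.symm] using hl
  have hlen := (hsupp l hl').1
  exact ⟨hlen, lt_of_le_of_ne (hmax l hl') fun h =>
    hlw (eq_of_wordValue_eq hn (hlen.trans (hsupp w hw).1.symm) h)⟩

/-- The degree `m` part of the two-sided ideal generated by an element `f` of degree `N`. -/
noncomputable def relationPart (f : TensorAlgebra k V) (N m : ℕ) :
    Submodule k (TensorAlgebra k V) :=
  ⨆ (p : ℕ × ℕ) (_ : p.1 + p.2 + N = m), degreeOne k V ^ p.1 * span k {f} * degreeOne k V ^ p.2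

theorem le_relationPart (f : TensorAlgebra k V) {N m p q : ℕ} (h : p + q + N = m) :
    degreeOne k V ^ p * span k {f} * degreeOne k V ^ q ≤ relationPart f N m :=
  le_iSup₂_of_le (p, q) h le_rfl

theorem relationPart_eq_bot (f : TensorAlgebra k V) {N m : ℕ} (h : m < N) :
    relationPart f N m = ⊥ := by
  simp only [relationPart, iSup_eq_bot]
  intro p hp
  omega

theorem relationPart_le_pow {f : TensorAlgebra k V} {N : ℕ} (hf : f ∈ degreeOne k V ^ N)
    (m : ℕ) : relationPart f N m ≤ degreeOne k V ^ m := by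
  refine iSup₂_le fun p hp => ?_
  have hR : span k {f} ≤ degreeOne k V ^ N := by simpa using hf
  calc _ ≤ degreeOne k V ^ p.1 * degreeOne k V ^ N * degreeOne k V ^ p.2 := by gcongr
    _ = degreeOne k V ^ m := by
      rw [← pow_add, ← pow_add]
      congr 1
      omega

/-- Words avoiding the leading word of `f` span the tensors of degree `m` modulo the ideal. -/
theorem degreeOne_pow_le_sup {n N : ℕ} (hn : 1 < n) (b : Basis (Fin n) k V)
    {f : TensorAlgebra k V} {w : List (Fin n)} (hw : w.length = N) {c : k} (hc : c ≠ 0)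
    (hf : f - c • wordProduct b w ∈
      span k (wordProduct b '' {l | l.length = N ∧ wordValue l < wordValue w})) (m : ℕ) :
    degreeOne k V ^ m ≤
      relationPart f N m ⊔ span k (wordProduct b '' wordsAvoiding w m) := by
  set T := relationPart f N m ⊔ span k (wordProduct b '' wordsAvoiding w m)
  suffices h : ∀ v : ℕ, ∀ l : List (Fin n), wordValue l = v → l.length = m →
      wordProduct b l ∈ T by
    rw [degreeOne_pow_eq_span b, span_le]
    rintro _ ⟨l, hl, rfl⟩
    exact h _ l rfl hl
  intro v
  induction v using Nat.strong_induction_on with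
  | _ v ih =>
  intro l hv hl
  by_cases hwl : w <:+: l
  · obtain ⟨p, q, rfl⟩ := hwl
    let φ : TensorAlgebra k V →ₗ[k] TensorAlgebra k V :=
      LinearMap.mulRight k (wordProduct b q) ∘ₗ LinearMap.mulLeft k (wordProduct b p)
    have hφ : ∀ l, φ (wordProduct b l) = wordProduct b (p ++ l ++ q) := fun l => by
      simp [φ, wordProduct_append, mul_assoc]
    have hlow : φ (f - c • wordProduct b w) ∈ T := by
      refine (map_span_le φ _ T).mpr ?_ (mem_map_of_mem hf)
      rintro _ ⟨l', ⟨hlen, hlt⟩, rfl⟩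
      rw [hφ]
      refine ih _ ?_ _ rfl ?_
      · rw [← hv]
        exact wordValue_append_lt hn (hlen.trans hw.symm) hlt p q
      · simpa [hlen, hw] using hl
    have hfT : φ f ∈ T := by
      refine mem_sup_left (le_relationPart f (p := p.length) (q := q.length) ?_
        (mul_mem_mul (mul_mem_mul (wordProduct_mem_pow b p) (mem_span_singleton_self f))
          (wordProduct_mem_pow b q)))
      simp only [List.length_append] at hl
      omega
    have : wordProduct b (p ++ w ++ q) = c⁻¹ • (φ f - φ (f - c • wordProduct b w)) := by
      rw [map_sub, sub_sub_cancel, map_smul, hφ, inv_smul_smul₀ hc]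
    rw [this]
    exact smul_mem _ _ (sub_mem hfT hlow)
  · exact mem_sup_right (subset_span ⟨l, ⟨hl, hwl⟩, rfl⟩)

theorem finrank_degreeOne_pow_le [FiniteDimensional k V] {n N : ℕ} (hn : 1 < n)
    (b : Basis (Fin n) k V) {f : TensorAlgebra k V} (hfN : f ∈ degreeOne k V ^ N)
    {w : List (Fin n)} (hw : w.length = N) {c : k} (hc : c ≠ 0)
    (hf : f - c • wordProduct b w ∈
      span k (wordProduct b '' {l | l.length = N ∧ wordValue l < wordValue w})) (m : ℕ) :
    finrank k (degreeOne k V ^ m : Submodule k (TensorAlgebra k V)) ≤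
      finrank k (relationPart f N m) + (wordsAvoiding w m).ncard := by
  have hfin := (wordsAvoiding_finite w m).image (wordProduct b)
  have : FiniteDimensional k (relationPart f N m) :=
    finiteDimensional_of_le (relationPart_le_pow hfN m)
  have : FiniteDimensional k (span k (wordProduct b '' wordsAvoiding w m)) :=
    FiniteDimensional.span_of_finite k hfin
  have := hfin.fintype
  calc _ ≤ _ := finrank_mono (degreeOne_pow_le_sup hn b hw hc hf m)
    _ ≤ _ := finrank_add_le_finrank_add_finrank _ _
    _ ≤ _ := by
      gcongr
      refine (finrank_span_le_card _).trans ?_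
      rw [← Set.ncard_eq_toFinset_card']
      exact Set.ncard_image_le (wordsAvoiding_finite w m)

theorem finrank_submodule_mul_le {A : Type*} [Ring A] [Algebra k A] (P Q : Submodule k A)
    [FiniteDimensional k P] [FiniteDimensional k Q] :
    finrank k (P * Q : Submodule k A) ≤ finrank k P * finrank k Q := by
  rw [← mulMap_range, ← finrank_tensorProduct]
  exact LinearMap.finrank_range_le _

theorem finrank_span_singleton_mul {f : TensorAlgebra k V} (hf0 : f ≠ 0)
    (Q : Submodule k (TensorAlgebra k V)) :
    finrank k (span k {f} * Q : Submodule k (TensorAlgebra k V)) = finrank k Q := by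
  have hinj : Function.Injective (LinearMap.mulLeft k f) := mul_right_injective₀ hf0
  have h : span k {f} * Q = Q.map (LinearMap.mulLeft k f) := by
    ext x
    simp [mem_span_singleton_mul]
  rw [h]
  exact (Submodule.equivMapOfInjective _ hinj Q).finrank_eq.symm

/-- The Golod–Shafarevich inequality for one relation. -/
theorem finrank_relationPart_add_le [FiniteDimensional k V] {f : TensorAlgebra k V}
    (hf0 : f ≠ 0) {r : ℕ} (hfN : f ∈ degreeOne k V ^ (r + 1)) (d : ℕ) :
    finrank k (relationPart f (r + 1) (d + r + 1)) + finrank k (relationPart f (r + 1) d) ≤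
      finrank k V * finrank k (relationPart f (r + 1) (d + r)) + finrank k V ^ d := by
  set D := degreeOne k V with hD
  have hfd : ∀ m, FiniteDimensional k (relationPart f (r + 1) m) := fun m =>
    finiteDimensional_of_le (relationPart_le_pow hfN m)
  have hDfd : FiniteDimensional k D := by
    rw [hD, ← pow_one (degreeOne k V)]
    infer_instance
  have hDrank : finrank k D = finrank k V := by
    rw [hD, ← pow_one (degreeOne k V), finrank_degreeOne_pow, pow_one]
  have hR : span k {f} ≤ D ^ (r + 1) := by simpa using hfN
  have hsup : relationPart f (r + 1) (d + r + 1) ≤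
      D * relationPart f (r + 1) (d + r) ⊔ span k {f} * D ^ d := by
    refine iSup₂_le ?_
    rintro ⟨_ | p, q⟩ hp
    · obtain rfl : q = d := by omega
      simp only [pow_zero, one_mul]
      exact le_sup_right
    · refine le_sup_of_le_left ?_
      rw [pow_succ', mul_assoc, mul_assoc, ← mul_assoc (D ^ p)]
      exact mul_le_mul_right (le_relationPart f (p := p) (q := q) (by omega)) D
  have hinf : span k {f} * relationPart f (r + 1) d ≤
      D * relationPart f (r + 1) (d + r) ⊓ span k {f} * D ^ d := by
    refine le_inf ?_ (mul_le_mul_right (relationPart_le_pow hfN d) _)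
    rw [relationPart, Submodule.mul_iSup]
    refine iSup_le fun p => ?_
    rw [Submodule.mul_iSup]
    refine iSup_le fun hp => ?_
    calc _ ≤ D ^ (r + 1) * (D ^ p.1 * span k {f} * D ^ p.2) := mul_le_mul_left hR _
      _ = D * (D ^ (r + p.1) * span k {f} * D ^ p.2) := by
        rw [pow_succ', pow_add]
        simp only [mul_assoc]
      _ ≤ _ := mul_le_mul_right (le_relationPart f (by omega)) D
  have hfd1 : FiniteDimensional k
      (D * relationPart f (r + 1) (d + r) : Submodule k (TensorAlgebra k V)) :=
    Module.Finite.iff_fg.mpr ((Module.Finite.iff_fg.mp hDfd).mul (Module.Finite.iff_fg.mp (hfd _)))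
  have hfd2 : FiniteDimensional k (span k {f} * D ^ d : Submodule k (TensorAlgebra k V)) :=
    Module.Finite.iff_fg.mpr ((fg_span_singleton f).mul
      (Module.Finite.iff_fg.mp (finiteDimensional_degreeOne_pow d)))
  have h1 := finrank_mono hsup
  have h2 := finrank_mono hinf
  have h3 := finrank_sup_add_finrank_inf_eq (D * relationPart f (r + 1) (d + r))
    (span k {f} * D ^ d)
  have h4 := finrank_submodule_mul_le D (relationPart f (r + 1) (d + r))
  rw [finrank_span_singleton_mul hf0] at h2 h3
  rw [finrank_degreeOne_pow] at h3
  rw [hDrank] at h4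
  omega

end TensorWords

/-- **Hilbert series `H_A(t) = (1 - n t + t^N)⁻¹` for a single antisymmetric relation.**
Over a field of characteristic zero, with `2 ≤ N ≤ n = dim V`, `f` a nonzero
antisymmetric element of degree `N`, `R = span {f}`, and
`S_m = ⨆_{p+q=m-N} 𝒱^p·R·𝒱^q` (`S_m = ⊥` for `m < N`), the integers
`a_m = dim 𝒱^m - dim S_m` satisfy `a_m = n^m` for `m ≤ N-1` and
`a_m = n·a_{m-1} - a_{m-N}` for `m ≥ N`. -/
theorem antisymmetric_relation_hilbert_series
    {k : Type*} [Field k] [CharZero k] {V : Type*} [AddCommGroup V] [Module k V]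
    [FiniteDimensional k V]
    (n : ℕ) (hn : Module.finrank k V = n)
    (N : ℕ) (hN2 : 2 ≤ N) (hNn : N ≤ n)
    (f : TensorAlgebra k V) (hf0 : f ≠ 0) (hfN : f ∈ (degreeOne k V) ^ N)
    (hfa : IsAntisymmetric k N f)
    (R : Submodule k (TensorAlgebra k V)) (hR : R = Submodule.span k {f})
    (S : ℕ → Submodule k (TensorAlgebra k V))
    (hSlt : ∀ m : ℕ, m < N → S m = ⊥)
    (hS : ∀ m : ℕ, N ≤ m → S m = ⨆ (p : ℕ × ℕ) (_ : p.1 + p.2 = m - N),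
        (degreeOne k V) ^ p.1 * R * (degreeOne k V) ^ p.2)
    (a : ℕ → ℤ)
    (ha : ∀ m : ℕ,
      a m = (Module.finrank k ((degreeOne k V) ^ m : Submodule k (TensorAlgebra k V)) : ℤ)
        - (Module.finrank k (S m) : ℤ)) :
    (∀ m : ℕ, m ≤ N - 1 → a m = (n : ℤ) ^ m) ∧
    (∀ m : ℕ, N ≤ m → a m = n * a (m - 1) - a (m - N)) := by
  have hSrel : ∀ m, S m = relationPart f N m := fun m => by
    rcases lt_or_ge m N with h | h
    · rw [hSlt m h, relationPart_eq_bot f h]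
    · rw [hS m h, relationPart, hR]
      refine iSup_congr fun p => iSup_congr_Prop ?_ fun _ => rfl
      omega
  have ha' : ∀ m, a m = (n : ℤ) ^ m - finrank k (relationPart f N m) := fun m => by
    rw [ha, hSrel, finrank_degreeOne_pow, hn, Nat.cast_pow]
  have hlow : ∀ m, m < N → a m = (n : ℤ) ^ m := fun m hm => by
    rw [ha', relationPart_eq_bot f hm, finrank_bot, Nat.cast_zero, sub_zero]
  refine ⟨fun m hm => hlow m (by omega), ?_⟩
  have hn1 : 1 < n := by omega
  let b : Basis (Fin n) k V := finBasisOfFinrankEq k V hn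
  obtain ⟨w, hwN, hwnd, c, hc, hfw⟩ := exists_leading_word hn1 b hf0 (hfa.mem_span_nodup b)
  obtain _ | ⟨x, t⟩ := w
  · simp only [List.length_nil] at hwN
    omega
  obtain rfl : N = t.length + 1 := by simpa using hwN.symm
  have hx : x ∉ t := (List.nodup_cons.mp hwnd).1
  have hupper : ∀ m, a m ≤ (wordsAvoiding (x :: t) m).ncard := fun m => by
    have h := finrank_degreeOne_pow_le hn1 b hfN hwN hc hfw m
    rw [finrank_degreeOne_pow, hn] at h
    rw [ha']
    zify at h
    linarith
  have hGS : ∀ d, n * a (d + t.length) - a d ≤ a (d + t.length + 1) := fun d => by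
    have h := finrank_relationPart_add_le hf0 hfN d
    rw [hn] at h
    zify at h
    simp only [ha', add_assoc] at h ⊢
    rw [← add_assoc d, pow_succ]
    linarith
  have hcount : ∀ d, ((wordsAvoiding (x :: t) (d + t.length + 1)).ncard : ℤ) ≤
      n * (wordsAvoiding (x :: t) (d + t.length)).ncard - (wordsAvoiding (x :: t) d).ncard :=
    fun d => by
      have h := ncard_wordsAvoiding_add_le hx d
      rw [Fintype.card_fin] at h
      zify at h
      linarith
  have heq : ∀ m, a m = (wordsAvoiding (x :: t) m).ncard := fun m => by
    induction m using Nat.strong_induction_on with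
    | _ m ih =>
    rcases lt_or_ge m (t.length + 1) with hm | hm
    · have hall : wordsAvoiding (x :: t) m = {l | l.length = m} := by
        ext l
        refine ⟨fun h => h.1, fun h => ⟨h, fun hw => ?_⟩⟩
        have := hw.length_le
        simp only [Set.mem_ofPred_eq, List.length_cons] at h this
        omega
      rw [hlow m hm, hall, ncard_setOf_length_eq, Fintype.card_fin, Nat.cast_pow]
    · obtain ⟨d, rfl⟩ : ∃ d, m = d + t.length + 1 := ⟨m - (t.length + 1), by omega⟩
      have h1 := hGS d
      rw [ih (d + t.length) (by omega), ih d (by omega)] at h1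
      exact le_antisymm (hupper _) ((hcount d).trans h1)
  intro m hm
  obtain ⟨d, rfl⟩ : ∃ d, m = d + t.length + 1 := ⟨m - (t.length + 1), by omega⟩
  have h1 : d + t.length + 1 - 1 = d + t.length := by omega
  have h2 : d + t.length + 1 - (t.length + 1) = d := by omega
  rw [h1, h2]
  refine le_antisymm ?_ (hGS d)
  rw [heq, heq, heq]
  exact hcount d
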